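/- Let σ > 1, δ > 0, and let a be a symbol of order 0 with constants (C_n). There exists a constant C such that for every integer k ≥ 1, all r₁, r₂ > 0 with 3/4 ≤ r₁ + r₂ ≤ 8/3 and 2^k r₁ r₂ ≥ 1, and every β ∈ [−π, π]: | a(2^k(r₁+r₂)) (1 + 2^k(r₁+r₂))^{-(3/2+δ)} ∫_0^{2σ} ( e^{i 2^k (d_s − (r₁+r₂))} − e^{i 2^k (r₁ r₂/(r₁+r₂)) s²} ) · 2σβ/(s² + β²) ds | ≤ C (1 + 2^k r₁ r₂)^{-1/2}, where d_s = d_s(r₁,r₂) = sqrt(r₁² + r₂² + 2 r₁ r₂ cosh s). -/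

import Mathlib

open MeasureTheory Real Set
open scoped ENNReal NNReal

noncomputable section

/-- The measure `r dr` on `(0,∞)`. -/
def radialMeasure : Measure ℝ :=
  (volume.restrict (Set.Ioi (0:ℝ))).withDensity fun r => ENNReal.ofReal r

/-- The measure `r dr dθ` on the flat cone `X = (0,∞) × [0, 2πσ)`. -/
def coneMeasure (σ : ℝ) : Measure (ℝ × ℝ) :=
  radialMeasure.prod (volume.restrict (Set.Ico (0:ℝ) (2*π*σ)))

/-- The integral operator on the flat cone associated with a kernel `K`. -/
def coneOp (σ : ℝ) (K : ℝ → ℝ → ℝ → ℝ → ℂ) (f : ℝ × ℝ → ℂ) : ℝ × ℝ → ℂ :=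
  fun x => ∫ θ₂ in Set.Ico (0:ℝ) (2*π*σ), ∫ r₂ in Set.Ioi (0:ℝ),
    K x.1 x.2 r₂ θ₂ * f (r₂, θ₂) * (r₂:ℂ)

/-- The critical Bochner–Riesz exponent `δ_c(p,2) = max {0, 2|1/2 − 1/p| − 1/2}`. -/
def deltaC (p : ℝ≥0∞) : ℝ := max 0 (2 * |1/2 - (1/p).toReal| - 1/2)

/-- `d_j(r₁,r₂,θ) = sqrt(r₁² + r₂² − 2 r₁ r₂ cos(θ + 2jσπ))`. -/
def dj (σ : ℝ) (j : ℤ) (r₁ r₂ θ : ℝ) : ℝ :=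
  Real.sqrt (r₁^2 + r₂^2 - 2*r₁*r₂*Real.cos (θ + 2*(j:ℝ)*σ*π))

/-- `d_s(r₁,r₂) = sqrt(r₁² + r₂² + 2 r₁ r₂ cosh s)`. -/
def dsc (s r₁ r₂ : ℝ) : ℝ := Real.sqrt (r₁^2 + r₂^2 + 2*r₁*r₂*Real.cosh s)

/-- The diffractive density `A_σ(s,θ)`. -/
def Asig (σ s θ : ℝ) : ℝ :=
  (1/2) * (Real.sin ((π - θ)/σ) / (Real.cosh (s/σ) - Real.cos ((π - θ)/σ)))
  + (1/2) * (Real.sin ((π + θ)/σ) / (Real.cosh (s/σ) - Real.cos ((π + θ)/σ)))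

/-- A symbol of order `0` with constants `Cn`: smooth on `(0,∞)` with
`|a^{(n)}(r)| ≤ Cn n (1+r)^{-n}`. -/
def IsSymbol0 (a : ℝ → ℂ) (Cn : ℕ → ℝ) : Prop :=
  ContDiffOn ℝ (⊤ : ℕ∞) a (Set.Ioi 0) ∧
  ∀ n : ℕ, ∀ r : ℝ, 0 < r →
    ‖iteratedDerivWithin n a (Set.Ioi 0) r‖ ≤ Cn n * (1 + r) ^ (-(n:ℝ))

/-- Littlewood–Paley-type pieces: `ψ_k = ψ(2^{-k}·)` for `k ≥ 1` and
`ψ₀ = 1 − Σ_{m≥1} ψ(2^{-m}·)` for `k = 0`. -/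
def psiK (ψ : ℝ → ℝ) (k : ℕ) (r : ℝ) : ℝ :=
  if k = 0 then 1 - ∑' m : ℕ, ψ (r / 2^(m+1)) else ψ (r / 2^k)

/-- The integral of the Poisson kernel over `[0, L]` is at most `π / 2`. -/
theorem intervalIntegral_poisson_le {b : ℝ} (hb : 0 < b) (L : ℝ) :
    ∫ s in (0:ℝ)..L, b / (s^2 + b^2) ≤ π / 2 := by
  have hderiv : ∀ s ∈ Set.uIcc 0 L,
      HasDerivAt (fun s : ℝ => Real.arctan (s / b)) (b / (s^2 + b^2)) s := by
    intro s _
    have h := ((hasDerivAt_id' s).div_const b).arctan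
    convert h using 1
    field_simp
    ring
  have hint : IntervalIntegrable (fun s : ℝ => b / (s^2 + b^2)) volume 0 L := by
    apply Continuous.intervalIntegrable
    exact continuous_const.div (by fun_prop) fun s => by positivity
  rw [intervalIntegral.integral_eq_sub_of_hasDerivAt hderiv hint]
  simpa using (Real.arctan_lt_pi_div_two (L / b)).le

/-- A function bounded by `M` integrates against the Poisson-type weight `c β / (s² + β²)`
to at most `M c π / 2`, uniformly in `β`. -/
theorem norm_intervalIntegral_mul_poisson_le {f : ℝ → ℂ} {M c L : ℝ} (hc : 0 ≤ c) (hL : 0 ≤ L)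
    (hf : ∀ s, ‖f s‖ ≤ M) (β : ℝ) :
    ‖∫ s in (0:ℝ)..L, f s * ((c * β / (s^2 + β^2) : ℝ) : ℂ)‖ ≤ M * c * (π / 2) := by
  have hM : 0 ≤ M := (norm_nonneg _).trans (hf 0)
  rcases eq_or_ne β 0 with rfl | hβ
  · simpa using by positivity
  have hb : 0 < |β| := abs_pos.mpr hβ
  calc ‖∫ s in (0:ℝ)..L, f s * ((c * β / (s^2 + β^2) : ℝ) : ℂ)‖
      ≤ ∫ s in (0:ℝ)..L, M * c * (|β| / (s^2 + |β|^2)) := by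
        refine intervalIntegral.norm_integral_le_of_norm_le hL (.of_forall fun s _ => ?_) ?_
        · have hw : ‖((c * β / (s^2 + β^2) : ℝ) : ℂ)‖ = c * (|β| / (s^2 + |β|^2)) := by
            rw [Complex.norm_real, Real.norm_eq_abs, abs_div, abs_mul, abs_of_nonneg hc, sq_abs,
              abs_of_nonneg (by positivity : 0 ≤ s^2 + β^2), mul_div_assoc]
          rw [norm_mul, hw, mul_assoc M c]
          gcongr
          exact hf s
        · apply Continuous.intervalIntegrable
          exact continuous_const.mul
            (continuous_const.div (by fun_prop) fun s => by positivity)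
    _ ≤ M * c * (π / 2) := by
        rw [intervalIntegral.integral_const_mul]
        gcongr
        exact intervalIntegral_poisson_le hb L

theorem norm_cexp_I_mul_sub_le_two (x y : ℝ) :
    ‖Complex.exp (Complex.I * (x : ℂ)) - Complex.exp (Complex.I * (y : ℂ))‖ ≤ 2 := by
  refine (norm_sub_le _ _).trans ?_
  rw [Complex.norm_exp_I_mul_ofReal, Complex.norm_exp_I_mul_ofReal]
  norm_num

theorem IsSymbol0.norm_le {a : ℝ → ℂ} {Cn : ℕ → ℝ} (ha : IsSymbol0 a Cn) {r : ℝ} (hr : 0 < r) :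
    ‖a r‖ ≤ Cn 0 := by
  simpa using ha.2 0 r hr

/-- replacing the phase `2^k(d_s − (r₁+r₂))` by its quadratic model
`2^k (r₁r₂/(r₁+r₂)) s²` produces an acceptable error. -/
theorem diffractive_quadratic_model_bound (σ δ : ℝ) (hσ : 1 < σ) (hδ : 0 < δ)
    (a : ℝ → ℂ) (Cn : ℕ → ℝ) (ha : IsSymbol0 a Cn) :
    ∃ C : ℝ, 0 < C ∧ ∀ k : ℕ, 1 ≤ k → ∀ r₁ r₂ : ℝ, 0 < r₁ → 0 < r₂ →
      3/4 ≤ r₁ + r₂ → r₁ + r₂ ≤ 8/3 → 1 ≤ 2^k * r₁ * r₂ →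
      ∀ β : ℝ, β ∈ Set.Icc (-π) π →
      ‖a ((2:ℝ)^k * (r₁ + r₂)) *
          (((1 + (2:ℝ)^k * (r₁ + r₂)) ^ (-(3/2 + δ)) : ℝ) : ℂ) *
          ∫ s in (0:ℝ)..(2*σ),
            (Complex.exp (Complex.I * (((2:ℝ)^k * (dsc s r₁ r₂ - (r₁ + r₂)) : ℝ) : ℂ))
              - Complex.exp (Complex.I * (((2:ℝ)^k * (r₁*r₂/(r₁+r₂)) * s^2 : ℝ) : ℂ))) *
            ((2*σ*β / (s^2 + β^2) : ℝ) : ℂ)‖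
        ≤ C * (1 + 2^k * r₁ * r₂) ^ (-(1/2) : ℝ) := by
  have hC : 0 ≤ Cn 0 := (norm_nonneg _).trans (ha.norm_le one_pos)
  refine ⟨Cn 0 * (2 * (2 * σ) * (π / 2)) + 1, by positivity, ?_⟩
  intro k _ r₁ r₂ h₁ h₂ _ hr _ β _
  have hN : (0:ℝ) < 2 ^ k := by positivity
  have hprod : (2:ℝ)^k * r₁ * r₂ ≤ 2^k * (r₁ + r₂) := by
    rw [mul_assoc]
    gcongr
    nlinarith [sq_nonneg (r₁ - r₂)]
  have hweight : (1 + (2:ℝ)^k * (r₁ + r₂)) ^ (-(3/2 + δ)) ≤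
      (1 + (2:ℝ)^k * r₁ * r₂) ^ (-(1/2) : ℝ) :=
    (Real.rpow_le_rpow_of_exponent_le (le_add_of_nonneg_right (by positivity))
      (by linarith)).trans
      (Real.rpow_le_rpow_of_nonpos (by positivity) (by linarith) (by norm_num))
  have hint := norm_intervalIntegral_mul_poisson_le (c := 2 * σ) (L := 2 * σ) (by positivity)
    (by positivity) (fun s => norm_cexp_I_mul_sub_le_two ((2:ℝ)^k * (dsc s r₁ r₂ - (r₁ + r₂)))
      ((2:ℝ)^k * (r₁*r₂/(r₁+r₂)) * s^2)) β
  have hw : 0 ≤ (1 + (2:ℝ)^k * (r₁ + r₂)) ^ (-(3/2 + δ)) := by positivity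
  rw [norm_mul, norm_mul, Complex.norm_real, Real.norm_of_nonneg hw]
  calc _ ≤ Cn 0 * (1 + (2:ℝ)^k * r₁ * r₂) ^ (-(1/2) : ℝ) * (2 * (2 * σ) * (π / 2)) := by
        gcongr
        exact ha.norm_le (by positivity)
    _ = Cn 0 * (2 * (2 * σ) * (π / 2)) * (1 + (2:ℝ)^k * r₁ * r₂) ^ (-(1/2) : ℝ) := by ring
    _ ≤ _ := by
        gcongr
        linarith
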